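/- Let K be a field, S = K[x₁,...,xₙ] a polynomial ring over K, and I ⊆ S a monomial ideal of height two such that S/I is Cohen–Macaulay. Then S/I is clean. -/

import Mathlib

open MvPolynomial

/-- The depth of an `S`-module `M` with respect to an ideal `m`: the supremum of
lengths of `M`-regular sequences consisting of elements of `m`. -/
noncomputable def mDepth (S : Type*) [CommRing S] (m : Ideal S)
    (M : Type*) [AddCommGroup M] [Module S M] : ℕ∞ :=
  sSup {n : ℕ∞ | ∃ rs : List S, (rs.length : ℕ∞) = n ∧ (∀ r ∈ rs, r ∈ m) ∧
    RingTheory.Sequence.IsRegular M rs}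

/-- `M` is a Cohen–Macaulay `S`-module (w.r.t. the ideal `m`) if its depth with
respect to `m` equals its Krull dimension, i.e. the Krull dimension of `S ⧸ ann M`. -/
def IsCM (S : Type*) [CommRing S] (m : Ideal S)
    (M : Type*) [AddCommGroup M] [Module S M] : Prop :=
  (mDepth S m M : WithBot ℕ∞) = ringKrullDim (S ⧸ Module.annihilator S M)

/-- `F` is a prime filtration `I = F₀ ⊆ F₁ ⊆ ... ⊆ F_r = S` with
`F_i/F_{i-1} ≅ S/P_i` for prime ideals `P_i`. -/
def IsPrimeFiltration {S : Type*} [CommRing S] (I : Ideal S) (r : ℕ)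
    (F : Fin (r + 1) → Ideal S) (P : Fin r → Ideal S) : Prop :=
  F 0 = I ∧ F (Fin.last r) = ⊤ ∧ (∀ i : Fin r, F i.castSucc ≤ F i.succ) ∧
  ∀ i : Fin r, (P i).IsPrime ∧
    Nonempty ((↥(Submodule.map (F i.castSucc).mkQ (F i.succ))) ≃ₗ[S] (S ⧸ P i))

/-- `S/I` is clean: it has a prime filtration all of whose primes are minimal
primes of `I`. -/
def IsClean {S : Type*} [CommRing S] (I : Ideal S) : Prop :=
  ∃ (r : ℕ) (F : Fin (r + 1) → Ideal S) (P : Fin r → Ideal S),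
    IsPrimeFiltration I r F P ∧ ∀ i, P i ∈ I.minimalPrimes

/-- `S/I` is pretty clean: it has a prime filtration such that `i ≤ j` and
`P i ⊆ P j` imply `P i = P j`. -/
def IsPrettyClean {S : Type*} [CommRing S] (I : Ideal S) : Prop :=
  ∃ (r : ℕ) (F : Fin (r + 1) → Ideal S) (P : Fin r → Ideal S),
    IsPrimeFiltration I r F P ∧ ∀ i j : Fin r, i ≤ j → P i ≤ P j → P i = P j

/-- A (finitely generated) `S`-module `M` is clean: it has a filtration
`0 = M₀ ⊆ M₁ ⊆ ... ⊆ M_r = M` with `M_i/M_{i-1} ≅ S/P_i` where each `P_i` is a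
minimal prime of the support of `M`, i.e. a minimal prime over `ann M`. -/
def IsCleanModule (S : Type*) [CommRing S] (M : Type*) [AddCommGroup M] [Module S M] : Prop :=
  ∃ (r : ℕ) (F : Fin (r + 1) → Submodule S M) (P : Fin r → Ideal S),
    F 0 = ⊥ ∧ F (Fin.last r) = ⊤ ∧ (∀ i : Fin r, F i.castSucc ≤ F i.succ) ∧
    (∀ i : Fin r, (P i).IsPrime ∧
      Nonempty ((↥(F i.succ) ⧸ (Submodule.comap (F i.succ).subtype (F i.castSucc)))
        ≃ₗ[S] (S ⧸ P i))) ∧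
    ∀ i, P i ∈ (Module.annihilator S M).minimalPrimes

/-- An ideal of a polynomial ring is a monomial ideal if it is generated by monomials. -/
def IsMonomialIdeal {σ K : Type*} [CommSemiring K] (I : Ideal (MvPolynomial σ K)) : Prop :=
  ∃ G : Set (MvPolynomial σ K),
    (∀ g ∈ G, ∃ e : σ →₀ ℕ, g = MvPolynomial.monomial e 1) ∧ I = Ideal.span G

/-- The height of an ideal: the infimum of the heights of the primes containing it. -/
noncomputable def idealHeight {S : Type*} [CommRing S] (I : Ideal S) : ℕ∞ :=
  sInf {n : ℕ∞ | ∃ q : PrimeSpectrum S, I ≤ q.asIdeal ∧ Order.height q = n}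

variable {K : Type*} [Field K] {n : ℕ}

local notation "Sn" => MvPolynomial (Fin n) K
local notation "mn" => (Ideal.span (Set.range (MvPolynomial.X : Fin n → MvPolynomial (Fin n) K)))

open CategoryTheory Abelian
universe u
section Ext
variable {R : Type u} [CommRing R]

lemma subsingleton_ext_X₁ {S : ShortComplex (ModuleCat.{u} R)} (hS : S.ShortExact)
    (N : ModuleCat.{u} R) (d : ℕ) (h₂ : ∀ i < d, Subsingleton (Ext N S.X₂ i))
    (h₃ : ∀ i, i + 1 < d → Subsingleton (Ext N S.X₃ i)) :
    ∀ i < d, Subsingleton (Ext N S.X₁ i) := by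
  intro i hi
  refine subsingleton_of_forall_eq 0 fun x => ?_
  have := h₂ i hi
  have h0 : x.comp (Ext.mk₀ S.f) (add_zero i) = 0 := Subsingleton.elim _ _
  cases i with
  | zero =>
    have := hS.mono_f
    exact Ext.postcomp_mk₀_injective_of_mono N S.f (h0.trans (by simp))
  | succ i =>
    obtain ⟨y, rfl⟩ := Ext.covariant_sequence_exact₁ N hS x h0 rfl
    have := h₃ i hi
    rw [Subsingleton.elim y 0, Ext.zero_comp]

lemma smul_ext_quotient_eq_zero {m : Ideal R} {r : R} (hr : r ∈ m) {X : ModuleCat.{u} R} {i : ℕ}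
    (x : Ext (ModuleCat.of R (R ⧸ m)) X i) : r • x = 0 := by
  have h : r • 𝟙 (ModuleCat.of R (R ⧸ m)) = 0 := by
    apply ModuleCat.hom_ext
    apply LinearMap.ext
    intro y
    obtain ⟨y, rfl⟩ := Ideal.Quotient.mk_surjective y
    change r • (Ideal.Quotient.mk m y) = 0
    rw [← Ideal.Quotient.mk_eq_mk, ← Submodule.Quotient.mk_smul,
      Submodule.Quotient.mk_eq_zero]
    exact m.mul_mem_right _ hr
  have : r • x = (Ext.mk₀ (r • 𝟙 (ModuleCat.of R (R ⧸ m)))).comp x (zero_add i) := by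
    simp [Ext.mk₀_smul]
  rw [this, h, Ext.mk₀_zero, Ext.zero_comp]

lemma subsingleton_ext_of_smul_factors {m : Ideal R} [hm : m.IsMaximal] {s : R} (hs : s ∉ m)
    {A B : ModuleCat.{u} R} (f : A ⟶ B) (g : B ⟶ A) (hfg : f ≫ g = s • 𝟙 A) (i : ℕ)
    (hB : Subsingleton (Ext (ModuleCat.of R (R ⧸ m)) B i)) :
    Subsingleton (Ext (ModuleCat.of R (R ⧸ m)) A i) := by
  refine subsingleton_of_forall_eq 0 fun x => ?_
  have h1 : s • x = 0 := by
    have : s • x = (x.comp (Ext.mk₀ f) (add_zero i)).comp (Ext.mk₀ g) (add_zero i) := by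
      rw [Ext.comp_assoc_of_third_deg_zero, Ext.mk₀_comp_mk₀, hfg]
      simp [Ext.mk₀_smul]
    rw [this, Subsingleton.elim (x.comp (Ext.mk₀ f) (add_zero i)) 0, Ext.zero_comp]
  obtain ⟨t, a, ha, hta⟩ := hm.exists_inv hs
  calc x = (t * s + a) • x := by rw [hta, one_smul]
    _ = 0 := by rw [add_smul, mul_smul, h1, smul_zero, smul_ext_quotient_eq_zero ha, zero_add]

lemma subsingleton_ext_pi {N : ModuleCat.{u} R} {i : ℕ} (h : Subsingleton (Ext N (ModuleCat.of R R) i))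
    (ι : Type) [Fintype ι] : Subsingleton (Ext N (ModuleCat.of R (ι → R)) i) := by
  classical
  refine subsingleton_of_forall_eq 0 fun x => ?_
  have hid : 𝟙 (ModuleCat.of R (ι → R)) =
      ∑ e : ι, ModuleCat.ofHom (LinearMap.proj e : (ι → R) →ₗ[R] R) ≫
        ModuleCat.ofHom (LinearMap.single R (fun _ : ι => R) e) := by
    ext1
    rw [ModuleCat.hom_sum]
    apply LinearMap.ext
    intro v
    funext j
    simp [LinearMap.sum_apply, Pi.single_apply]
  rw [← Ext.comp_mk₀_id x, hid, Ext.mk₀_sum, Ext.comp_sum]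
  refine Finset.sum_eq_zero fun e _ => ?_
  rw [← Ext.mk₀_comp_mk₀, ← Ext.comp_assoc_of_third_deg_zero,
    Subsingleton.elim (x.comp (Ext.mk₀ (ModuleCat.ofHom (LinearMap.proj e))) (add_zero i)) 0,
    Ext.zero_comp]

lemma hasProjectiveDimensionLT_quotient_of_isWeaklyRegular (rs : List R) :
    ∀ (M : ModuleCat.{u} R) (d : ℕ), HasProjectiveDimensionLT M d →
      RingTheory.Sequence.IsWeaklyRegular M rs →
      HasProjectiveDimensionLT
        (ModuleCat.of R (M ⧸ (Ideal.ofList rs • (⊤ : Submodule R M)))) (d + rs.length) := by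
  induction rs with
  | nil =>
    intro M d hM _
    have e : (M ⧸ (Ideal.ofList ([] : List R) • (⊤ : Submodule R M))) ≃ₗ[R] M :=
      Submodule.quotEquivOfEqBot _ (by simp)
    exact hasProjectiveDimensionLT_of_iso e.symm.toModuleIso d
  | cons r rs ih =>
    intro M d hM hreg
    rw [RingTheory.Sequence.isWeaklyRegular_cons_iff] at hreg
    have h1 : HasProjectiveDimensionLT (ModuleCat.of R (QuotSMulTop r M)) (d + 1) :=
      hreg.1.smulShortComplex_shortExact.hasProjectiveDimensionLT_X₃ d hM
        (hasProjectiveDimensionLT_of_ge M d (d + 1) (Nat.le_succ d))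
    have h2 := ih (ModuleCat.of R (QuotSMulTop r M)) (d + 1) h1 hreg.2
    rw [List.length_cons, show d + (rs.length + 1) = d + 1 + rs.length by ring]
    exact hasProjectiveDimensionLT_of_iso
      (Submodule.quotOfListConsSMulTopEquivQuotSMulTopInner M r rs).symm.toModuleIso _

end Ext

section Vars

lemma isPrime_span_X_image {σ R : Type*} [CommRing R] [IsDomain R] (s : Set σ) :
    (Ideal.span (X '' s : Set (MvPolynomial σ R))).IsPrime := by
  classical
  let φ : MvPolynomial σ R →ₐ[R] MvPolynomial σ R := aeval fun i => if i ∈ s then 0 else X i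
  have h1 : ∀ f, f - φ f ∈ Ideal.span (X '' s : Set (MvPolynomial σ R)) := by
    intro f
    induction f using MvPolynomial.induction_on with
    | C a => simp [φ]
    | add p q hp hq => rw [map_add, add_sub_add_comm]; exact Ideal.add_mem _ hp hq
    | mul_X p i hp =>
      by_cases hi : i ∈ s
      · have : φ (p * X i) = 0 := by simp [φ, hi]
        rw [this, sub_zero]
        exact Ideal.mul_mem_left _ _ (Ideal.subset_span ⟨i, hi, rfl⟩)
      · have : φ (p * X i) = φ p * X i := by simp [φ, hi]
        rw [this, ← sub_mul]
        exact Ideal.mul_mem_right _ _ hp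
  have h2 : Ideal.span (X '' s) = RingHom.ker φ.toRingHom := by
    apply le_antisymm
    · rw [Ideal.span_le]
      rintro _ ⟨i, hi, rfl⟩
      simp [φ, hi]
    · intro f hf
      have := h1 f
      rwa [show φ f = 0 from hf, sub_zero] at this
  rw [h2]
  exact RingHom.ker_isPrime _

lemma X_mem_span_X_image {σ R : Type*} [CommRing R] [Nontrivial R] {s : Set σ} {i : σ} :
    (X i : MvPolynomial σ R) ∈ Ideal.span (X '' s : Set (MvPolynomial σ R)) ↔ i ∈ s := by
  classical
  rw [mem_ideal_span_X_image]
  simp [support_X, Finsupp.single_apply]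

lemma mem_span_range_X_iff {σ R : Type*} [CommRing R] {f : MvPolynomial σ R} :
    f ∈ Ideal.span (Set.range X) ↔ constantCoeff f = 0 := by
  rw [← Set.image_univ, mem_ideal_span_X_image, constantCoeff_eq]
  constructor
  · intro h
    by_contra h0
    obtain ⟨i, -, hi⟩ := h 0 (by simpa using h0)
    exact hi rfl
  · intro h d hd
    by_contra! h1
    have : d = 0 := Finsupp.ext fun i => h1 i trivial
    subst this
    simp [h] at hd

instance isMaximal_span_range_X {σ : Type*} :
    (Ideal.span (Set.range X) : Ideal (MvPolynomial σ K)).IsMaximal := by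
  have : Ideal.span (Set.range X) = RingHom.ker (constantCoeff (R := K) (σ := σ)) := by
    ext f
    rw [mem_span_range_X_iff, RingHom.mem_ker]
  rw [this]
  exact RingHom.ker_isMaximal_of_surjective _ fun a => ⟨C a, constantCoeff_C σ a⟩

lemma isSMulRegular_quotient_of_isPrime {R : Type*} [CommRing R] {P : Ideal R} [P.IsPrime] {r : R}
    (hr : r ∉ P) : IsSMulRegular (R ⧸ P) r := by
  intro x y hxy
  have : Ideal.Quotient.mk P r * x = Ideal.Quotient.mk P r * y := hxy
  exact mul_left_cancel₀ (by rwa [Ne, Ideal.Quotient.eq_zero_iff_mem]) this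

variable (K n) in
lemma isWeaklyRegular_ofFn_X :
    RingTheory.Sequence.IsWeaklyRegular (MvPolynomial (Fin n) K)
      (List.ofFn (X : Fin n → MvPolynomial (Fin n) K)) := by
  rw [RingTheory.Sequence.isWeaklyRegular_iff]
  intro i hi
  have hi' : i < n := by simpa using hi
  have h : (Ideal.ofList ((List.ofFn (X : Fin n → MvPolynomial (Fin n) K)).take i) •
      (⊤ : Ideal (MvPolynomial (Fin n) K))) = Ideal.span (X '' {j : Fin n | j.1 < i}) := by
    rw [smul_eq_mul, Ideal.mul_top, Ideal.ofList]
    congr 1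
    ext f
    simp only [List.mem_take_iff_getElem, Set.mem_ofPred_eq, Set.mem_image]
    constructor
    · rintro ⟨k, hk, rfl⟩
      simp only [List.length_ofFn, lt_inf_iff] at hk
      exact ⟨⟨k, hk.2⟩, hk.1, by simp⟩
    · rintro ⟨k, hk, rfl⟩
      exact ⟨k, by simp [hk], by simp⟩
  rw [h]
  have := isPrime_span_X_image (R := K) {j : Fin n | j.1 < i}
  apply isSMulRegular_quotient_of_isPrime
  rw [List.getElem_ofFn, X_mem_span_X_image]
  simp

variable (K n) in
lemma ofList_ofFn_X : Ideal.ofList (List.ofFn (X : Fin n → MvPolynomial (Fin n) K)) =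
    Ideal.span (Set.range X) := by
  rw [Ideal.ofList]
  congr 1
  ext f
  simp [List.mem_ofFn]
end Vars

section
variable {R : Type u} [CommRing R]

lemma length_le_supportDim_of_isRegular [IsNoetherianRing R] (rs : List R) :
    ∀ (M : Type u) [AddCommGroup M] [Module R M] [Module.Finite R M],
      RingTheory.Sequence.IsRegular M rs → (rs.length : WithBot ℕ∞) ≤ Module.supportDim R M := by
  induction rs with
  | nil =>
    intro M _ _ _ h
    have : Nontrivial M := h.nontrivial
    have h1 := (Module.supportDim_ne_bot_iff_nontrivial (R := R) (M := M)).mpr this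
    obtain ⟨a, ha⟩ := WithBot.ne_bot_iff_exists.mp h1
    rw [← ha]
    exact WithBot.coe_le_coe.mpr (by simp)
  | cons r rs ih =>
    intro M _ _ _ h
    rw [RingTheory.Sequence.isRegular_cons_iff] at h
    have h1 := ih _ h.2
    have h2 := Module.supportDim_quotSMulTop_succ_le_of_notMem_minimalPrimes (R := R) (M := M)
      (fun _ ↦ h.1.notMem_of_mem_minimalPrimes)
    refine le_trans ?_ h2
    rw [List.length_cons, Nat.cast_succ]
    gcongr

lemma ext_comp_eq_zero_of_forall_apply_mem {N : ModuleCat.{u} R} {n : ℕ} {m : Ideal R}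
    (hm : m.FG) (hN : ∀ r ∈ m, ∀ (Y : ModuleCat.{u} R) (x : Ext N Y n), r • x = 0)
    (hpd : HasProjectiveDimensionLT N (n + 1)) {L : ModuleCat.{u} R} {ι : Type} [Finite ι]
    (f : L →ₗ[R] (ι → R)) (hf : ∀ l e, f l e ∈ m) (x : Ext N L n) :
    x.comp (Ext.mk₀ (ModuleCat.ofHom f : L ⟶ ModuleCat.of R (ι → R))) (add_zero n) = 0 := by
  obtain ⟨s, rfl⟩ := hm
  let q : (L →₀ R) →ₗ[R] L := Finsupp.linearCombination R id
  have hq : Function.Surjective q := fun l => ⟨Finsupp.single l 1, by simp [q]⟩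
  have hS := LinearMap.shortExact_shortComplexKer hq
  obtain ⟨y, hy⟩ := Ext.covariant_sequence_exact₃ N hS x rfl
    (Ext.eq_zero_of_hasProjectiveDimensionLT _ (n + 1) le_rfl)
  have hc : ∀ l e, ∃ c : s → R, ∑ r, c r * (r : R) = f l e := by
    intro l e
    have := hf l e
    rw [← Subtype.range_coe (s := (s : Set R))] at this
    exact (Ideal.mem_span_range_iff_exists_fun).mp this
  choose c hc using hc
  let g : s → ((L →₀ R) →ₗ[R] (ι → R)) := fun r =>
    Finsupp.linearCombination R (fun l e => c l e r)
  have hg : f ∘ₗ q = ∑ r : s, (r : R) • g r := by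
    apply Finsupp.lhom_ext'
    intro l
    apply LinearMap.ext_ring
    funext e
    simp [q, g, ← hc, mul_comm]
  have hg' : (LinearMap.shortComplexKer q).g ≫
      (ModuleCat.ofHom f : L ⟶ ModuleCat.of R (ι → R)) = ∑ r : s, (r : R) • ModuleCat.ofHom (g r) := by
    apply ModuleCat.hom_ext
    rw [ModuleCat.hom_sum]
    exact hg
  rw [← hy, Ext.comp_assoc_of_third_deg_zero, Ext.mk₀_comp_mk₀, hg', Ext.mk₀_sum, Ext.comp_sum]
  refine Finset.sum_eq_zero fun r _ => ?_
  rw [Ext.mk₀_smul, Ext.comp_smul]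
  exact hN _ (Ideal.subset_span r.2) _ _

lemma subsingleton_ext_of_linearEquiv {N : ModuleCat.{u} R} {i : ℕ} {A B : Type u} [AddCommGroup A]
    [Module R A] [AddCommGroup B] [Module R B] (e : A ≃ₗ[R] B)
    (hB : Subsingleton (Ext N (ModuleCat.of R B) i)) : Subsingleton (Ext N (ModuleCat.of R A) i) := by
  refine subsingleton_of_forall_eq 0 fun x => ?_
  rw [← Ext.comp_mk₀_id x, ← e.toModuleIso.hom_inv_id, ← Ext.mk₀_comp_mk₀,
    ← Ext.comp_assoc_of_third_deg_zero,
    Subsingleton.elim (x.comp (Ext.mk₀ e.toModuleIso.hom) (add_zero i)) 0, Ext.zero_comp]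

lemma subsingleton_ext_syzygies {N : ModuleCat.{u} R} {n k : ℕ} (hnk : n ≤ k + 2)
    (hR : ∀ i < n, Subsingleton (Ext N (ModuleCat.of R R) i)) {I : Ideal R}
    (hM : ∀ i < k, Subsingleton (Ext N (ModuleCat.of R (R ⧸ I)) i)) {ι : Type} [Fintype ι]
    (φ : (ι → R) →ₗ[R] R) (hφ : LinearMap.range φ = I) :
    ∀ i < n, Subsingleton (Ext N (ModuleCat.of R (LinearMap.ker φ)) i) := by
  subst hφ
  intro i hi
  have h1 := LinearMap.shortExact_shortComplexKer (LinearMap.range φ).mkQ_surjective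
  have h2 := LinearMap.shortExact_shortComplexKer φ.surjective_rangeRestrict
  have h3 := subsingleton_ext_X₁ h1 N (n - 1) (fun i hi => hR i (by omega))
    (fun i hi => hM i (by omega))
  have e1 : (LinearMap.ker (LinearMap.range φ).mkQ) ≃ₗ[R] LinearMap.range φ :=
    LinearEquiv.ofEq _ _ (Submodule.ker_mkQ _)
  have e2 : (LinearMap.ker φ.rangeRestrict) ≃ₗ[R] LinearMap.ker φ :=
    LinearEquiv.ofEq _ _ (LinearMap.ker_rangeRestrict φ)
  exact subsingleton_ext_of_linearEquiv e2.symm <|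
    subsingleton_ext_X₁ h2 N n (fun i hi => subsingleton_ext_pi (hR i hi) ι)
      (fun i hi => subsingleton_ext_of_linearEquiv e1.symm (h3 i (by omega))) i hi

lemma linearIndependent_of_subsingleton_ext [IsDomain R] [IsNoetherianRing R] {n : ℕ}
    {m : Ideal R} [hm : m.IsMaximal] (hdim : ringKrullDim R ≤ n)
    (hR : ∀ i < n, Subsingleton (Ext (ModuleCat.of R (R ⧸ m)) (ModuleCat.of R R) i))
    (hpd : HasProjectiveDimensionLT (ModuleCat.of R (R ⧸ m)) (n + 1))
    {V : Type u} [AddCommGroup V] [Module R V] (W : Submodule R V)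
    (hW : ∀ i < n, Subsingleton (Ext (ModuleCat.of R (R ⧸ m)) (ModuleCat.of R W) i))
    {E : Type} [Fintype E] (v : E → V) (hv : ∀ e, v e ∈ W) {s : R} (hs : s ∉ m)
    (hsW : ∀ w ∈ W, s • w ∈ Submodule.span R (Set.range v))
    (hmin : ∀ a : E → R, ∑ e, a e • v e = 0 → ∀ e, a e ∈ m) : LinearIndependent R v := by
  let k0 := ModuleCat.of R (R ⧸ m)
  let τ : (E → R) →ₗ[R] V := Fintype.linearCombination R v
  have hτ : LinearMap.range τ = Submodule.span R (Set.range v) := Fintype.range_linearCombination R v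
  have hle : LinearMap.range τ ≤ W := by
    rw [hτ, Submodule.span_le]
    rintro _ ⟨e, rfl⟩
    exact hv e
  have hrange : ∀ i < n, Subsingleton (Ext k0 (ModuleCat.of R (LinearMap.range τ)) i) := by
    intro i hi
    let f : LinearMap.range τ →ₗ[R] W := Submodule.inclusion hle
    let g : W →ₗ[R] LinearMap.range τ :=
      (s • W.subtype).codRestrict (LinearMap.range τ) (fun w => hτ ▸ hsW w w.2)
    refine subsingleton_ext_of_smul_factors hs (ModuleCat.ofHom f) (ModuleCat.ofHom g) ?_ i (hW i hi)
    apply ModuleCat.hom_ext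
    apply LinearMap.ext
    intro x
    rfl
  have hS := LinearMap.shortExact_shortComplexKer τ.surjective_rangeRestrict
  let L := LinearMap.ker τ.rangeRestrict
  have hL : ∀ i < n, Subsingleton (Ext k0 (ModuleCat.of R L) i) :=
    subsingleton_ext_X₁ hS k0 n (fun i hi => subsingleton_ext_pi (hR i hi) E)
      (fun i hi => hrange i (by omega))
  have hmL : ∀ (l : L) e, l.1 e ∈ m := fun l e =>
    hmin l.1
    ((Fintype.linearCombination_apply R v l.1).symm.trans
      (congrArg Subtype.val (LinearMap.mem_ker.mp l.2))) e
  have hLn : Subsingleton (Ext k0 (ModuleCat.of R L) n) := by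
    refine subsingleton_of_forall_eq 0 fun x => ?_
    have h0 := ext_comp_eq_zero_of_forall_apply_mem (N := k0) (n := n) (L := ModuleCat.of R L)
      (IsNoetherian.noetherian m) (fun r hr Y y => smul_ext_quotient_eq_zero hr y) hpd
      L.subtype hmL x
    cases n with
    | zero =>
      have := hS.mono_f
      exact Ext.postcomp_mk₀_injective_of_mono k0 _ (h0.trans (by simp))
    | succ n =>
      obtain ⟨y, rfl⟩ := Ext.covariant_sequence_exact₁ k0 hS x h0 rfl
      have := hrange n (Nat.lt_succ_self n)
      rw [Subsingleton.elim y 0, Ext.zero_comp]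
  have hLtop : m • (⊤ : Submodule R L) = ⊤ := by
    by_contra hne
    obtain ⟨rs, hlen, -, hreg⟩ := ModuleCat.exists_isRegular_of_exists_subsingleton_ext m (n + 1)
      (ModuleCat.of R L) (lt_top_iff_ne_top.mpr hne) k0 (by
        rw [Module.support_eq_zeroLocus]
        exact congrArg _ (congrArg _ (Ideal.annihilator_quotient)))
      (fun i hi => (Nat.lt_succ_iff_lt_or_eq.mp hi).elim (hL i) (fun h => h ▸ hLn))
    have h1 := (length_le_supportDim_of_isRegular rs L hreg).trans
      ((Module.supportDim_le_ringKrullDim R L).trans hdim)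
    rw [hlen] at h1
    have : n + 1 ≤ n := by exact_mod_cast h1
    omega
  have hLbot : ∀ l : L, l = 0 := by
    intro l
    obtain ⟨r, hr, hr0⟩ := Submodule.exists_sub_one_mem_and_smul_eq_zero_of_fg_of_le_smul m
      (⊤ : Submodule R L) (IsNoetherian.noetherian _) hLtop.ge
    have hrne : r ≠ 0 := by
      rintro rfl
      exact hm.ne_top ((Ideal.eq_top_iff_one m).mpr (by simpa using hr))
    have := hr0 l trivial
    exact (smul_eq_zero.mp this).resolve_left hrne
  rw [Fintype.linearIndependent_iff]
  intro a ha e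
  have := hLbot ⟨a, by
    rw [LinearMap.mem_ker]
    apply Subtype.ext
    simpa [τ, Fintype.linearCombination_apply] using ha⟩
  exact congrFun (congrArg Subtype.val this) e

end

section
variable {ι : Type*}

/-- The monomial syzygy between the monomials with exponents `u e.1` and `u e.2`. -/
noncomputable def monomialSyzygy (K : Type*) [Field K] {n : ℕ} {ι : Type*} [DecidableEq ι]
    (u : ι → Fin n →₀ ℕ) (e : ι × ι) : ι → MvPolynomial (Fin n) K :=
  Pi.single e.1 (monomial ((u e.1 ⊔ u e.2) - u e.1) 1) -
    Pi.single e.2 (monomial ((u e.1 ⊔ u e.2) - u e.2) 1)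

lemma sum_monomialSyzygy_mul [Fintype ι] [DecidableEq ι] (u : ι → Fin n →₀ ℕ) (e : ι × ι) :
    ∑ g, monomialSyzygy K u e g * monomial (u g) 1 = 0 := by
  have h1 : (u e.1 ⊔ u e.2) - u e.1 + u e.1 = u e.1 ⊔ u e.2 := tsub_add_cancel_of_le le_sup_left
  have h2 : (u e.1 ⊔ u e.2) - u e.2 + u e.2 = u e.1 ⊔ u e.2 := tsub_add_cancel_of_le le_sup_right
  simp [monomialSyzygy, sub_mul, Finset.sum_sub_distrib, Pi.single_apply, monomial_mul, h1, h2]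

lemma mem_span_monomialSyzygy [Fintype ι] [DecidableEq ι] (u : ι → Fin n →₀ ℕ)
    (z : ι → MvPolynomial (Fin n) K) (hz : ∑ g, z g * monomial (u g) 1 = 0) :
    z ∈ Submodule.span (MvPolynomial (Fin n) K) (Set.range (monomialSyzygy K u)) := by
  classical
  set T := Submodule.span (MvPolynomial (Fin n) K) (Set.range (monomialSyzygy K u))
  let ψ : MvPolynomial (Fin n) K →ₗ[K] (ι → MvPolynomial (Fin n) K) :=
    (basisMonomials (Fin n) K).constr K fun d =>
      if h : ∃ g, u g ≤ d then Pi.single h.choose (monomial (d - u h.choose) 1) else 0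
  have hψ : ∀ d c, (∃ g, u g ≤ d) →
      ∃ g, u g ≤ d ∧ ψ (monomial d c) = Pi.single g (monomial (d - u g) c) := by
    intro d c h
    refine ⟨h.choose, h.choose_spec, ?_⟩
    have : ψ (monomial d 1) = Pi.single h.choose (monomial (d - u h.choose) 1) := by
      have h1 := (basisMonomials (Fin n) K).constr_basis K (fun d =>
        if h : ∃ g, u g ≤ d then Pi.single h.choose (monomial (d - u h.choose) (1 : K))
          else (0 : ι → MvPolynomial (Fin n) K)) d
      rw [coe_basisMonomials, dif_pos h] at h1
      exact h1
    rw [show (monomial d c : MvPolynomial (Fin n) K) = c • monomial d 1 by simp [smul_monomial],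
      map_smul, this, ← Pi.single_smul, smul_monomial]
    simp
  have key : ∀ g f, Pi.single g f - ψ (f * monomial (u g) 1) ∈ T := by
    intro g f
    induction f using MvPolynomial.induction_on' with
    | monomial m c =>
      rw [monomial_mul, mul_one]
      obtain ⟨g', hg', h⟩ := hψ (m + u g) c ⟨g, le_add_self⟩
      rw [h]
      have : Pi.single g (monomial m c) - Pi.single g' (monomial (m + u g - u g') c) =
          (monomial (m + u g - (u g ⊔ u g')) c : MvPolynomial (Fin n) K) •
            monomialSyzygy K u (g, g') := by
        rw [monomialSyzygy, smul_sub, ← Pi.single_smul, ← Pi.single_smul, smul_eq_mul, smul_eq_mul,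
          monomial_mul, monomial_mul, mul_one]
        congr 4
        · ext i
          have := hg' i
          simp at this ⊢
          omega
        · ext i
          have := hg' i
          simp at this ⊢
          omega
      rw [this]
      exact T.smul_mem _ (Submodule.subset_span ⟨_, rfl⟩)
    | add p q hp hq =>
      rw [Pi.single_add, add_mul, map_add, add_sub_add_comm]
      exact T.add_mem hp hq
  have : z = ∑ g, (Pi.single g (z g) - ψ (z g * monomial (u g) 1)) := by
    rw [Finset.sum_sub_distrib, ← map_sum, hz, map_zero, sub_zero, Finset.univ_sum_single]
  rw [this]
  exact Submodule.sum_mem _ fun g _ => key g (z g)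
end

lemma exists_monomialSyzygy_finset {K : Type*} [Field K] {n : ℕ} {ι : Type} [Fintype ι]
    [DecidableEq ι] [Nonempty ι] (u : ι → Fin n →₀ ℕ) {I : Ideal (MvPolynomial (Fin n) K)}
    (hI : I = Ideal.span (Set.range fun g => monomial (u g) 1))
    (hIm : I ≤ Ideal.span (Set.range X))
    (rs : List (MvPolynomial (Fin n) K)) (hrs : ∀ r ∈ rs, r ∈ Ideal.span (Set.range X))
    (hreg : RingTheory.Sequence.IsRegular (MvPolynomial (Fin n) K ⧸ I) rs)
    (hn : n ≤ rs.length + 2) :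
    ∃ E : Finset (ι × ι), (∀ e ∈ E, e.1 ≠ e.2) ∧ E.card < Fintype.card ι ∧
      ∀ z : ι → MvPolynomial (Fin n) K, ∑ g, z g * monomial (u g) 1 = 0 →
        ∃ s ∉ (Ideal.span (Set.range X) : Ideal (MvPolynomial (Fin n) K)), ∃ a : ι × ι → MvPolynomial (Fin n) K,
          s • z = ∑ e ∈ E, a e • monomialSyzygy K u e := by
  set m : Ideal (MvPolynomial (Fin n) K) := Ideal.span (Set.range X) with hmdef
  let k0 := ModuleCat.of (MvPolynomial (Fin n) K) (MvPolynomial (Fin n) K ⧸ m)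
  have hmtop : m ≠ ⊤ := Ideal.IsMaximal.ne_top inferInstance
  have hsupp : Module.support (MvPolynomial (Fin n) K) k0 ⊆ PrimeSpectrum.zeroLocus m := by
    rw [Module.support_eq_zeroLocus]
    exact (congrArg _ (congrArg _ (Ideal.annihilator_quotient))).le
  have hofList := ofList_ofFn_X K n
  have hR : ∀ i < n, Subsingleton (Ext k0 (ModuleCat.of _ (MvPolynomial (Fin n) K)) i) := by
    intro i hi
    refine ModuleCat.subsingleton_ext_of_exists_isRegular m k0 hsupp _ ?_ (List.ofFn X)
      (fun r hr => ?_) ⟨isWeaklyRegular_ofFn_X K n, ?_⟩ i (by simpa using hi)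
    · exact lt_top_iff_ne_top.mpr (by simpa using hmtop)
    · obtain ⟨j, rfl⟩ := List.mem_ofFn.mp hr
      exact Ideal.subset_span ⟨j, rfl⟩
    · rw [hofList]
      simpa using hmtop.symm
  have hpd : HasProjectiveDimensionLT k0 (n + 1) := by
    have h1 : HasProjectiveDimensionLT
      (ModuleCat.of (MvPolynomial (Fin n) K) (MvPolynomial (Fin n) K)) 1 := inferInstance
    have h2 := hasProjectiveDimensionLT_quotient_of_isWeaklyRegular _ _ _ h1
      (isWeaklyRegular_ofFn_X K n)
    have e : (MvPolynomial (Fin n) K ⧸ (Ideal.ofList (List.ofFn X) •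
        (⊤ : Submodule (MvPolynomial (Fin n) K) (MvPolynomial (Fin n) K)))) ≃ₗ[MvPolynomial (Fin n) K]
        (MvPolynomial (Fin n) K ⧸ m) :=
      Submodule.quotEquivOfEq _ _ (by rw [hofList]; simp [m])
    have h3 : 1 + (List.ofFn (X : Fin n → MvPolynomial (Fin n) K)).length = n + 1 := by
      simp [add_comm]
    rw [h3] at h2
    exact hasProjectiveDimensionLT_of_iso e.toModuleIso _
  have hdim : ringKrullDim (MvPolynomial (Fin n) K) ≤ n := by
    rw [MvPolynomial.ringKrullDim_of_isNoetherianRing]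
    simp
  let φ : (ι → MvPolynomial (Fin n) K) →ₗ[MvPolynomial (Fin n) K] MvPolynomial (Fin n) K :=
    Fintype.linearCombination _ fun g => monomial (u g) 1
  have hφ : ∀ z, φ z = ∑ g, z g * monomial (u g) 1 := fun z => rfl
  have hφI : LinearMap.range φ = I := by
    rw [hI]
    exact Fintype.range_linearCombination _ _
  have hM : ∀ i < rs.length,
      Subsingleton (Ext k0 (ModuleCat.of _ (MvPolynomial (Fin n) K ⧸ I)) i) := by
    refine ModuleCat.subsingleton_ext_of_exists_isRegular m k0 hsupp _ ?_ rs hrs hreg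
    rw [lt_top_iff_ne_top]
    intro h
    have h1 : m • (⊤ : Submodule (MvPolynomial (Fin n) K) (MvPolynomial (Fin n) K ⧸ I)) ≤
        Submodule.map I.mkQ m := by
      rw [Submodule.smul_le]
      intro r hr y _
      obtain ⟨y, rfl⟩ := Submodule.mkQ_surjective _ y
      exact ⟨r * y, m.mul_mem_right _ hr, rfl⟩
    obtain ⟨r, hr, h2⟩ := h1 (h.ge (Submodule.mem_top (x := I.mkQ 1)))
    have h3 : r - 1 ∈ m := hIm ((Submodule.Quotient.eq I).mp h2)
    exact hmtop ((Ideal.eq_top_iff_one m).mpr (by simpa using m.sub_mem hr h3))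
  have hW := subsingleton_ext_syzygies hn hR hM φ hφI
  have hker : ∀ e, monomialSyzygy K u e ∈ LinearMap.ker φ := fun e =>
    LinearMap.mem_ker.mpr ((hφ _).trans (sum_monomialSyzygy_mul u e))
  let good : Set (Finset (ι × ι)) := {E | (∀ e ∈ E, e.1 ≠ e.2) ∧ ∃ s ∉ m, ∀ w ∈ LinearMap.ker φ,
    s • w ∈ Submodule.span (MvPolynomial (Fin n) K) (monomialSyzygy K u '' E)}
  have hgood : good.Nonempty := by
    refine ⟨Finset.univ.filter fun e => e.1 ≠ e.2, by simp, 1,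
      fun h => hmtop ((Ideal.eq_top_iff_one m).mpr h), fun w hw => ?_⟩
    rw [one_smul]
    have := mem_span_monomialSyzygy u w ((hφ w).symm.trans (LinearMap.mem_ker.mp hw))
    refine Submodule.span_le.mpr ?_ this
    rintro _ ⟨e, rfl⟩
    by_cases he : e.1 = e.2
    · have : monomialSyzygy K u e = 0 := by
        obtain ⟨a, b⟩ := e
        obtain rfl : a = b := he
        simp [monomialSyzygy]
      rw [this]
      exact Submodule.zero_mem _
    · exact Submodule.subset_span ⟨e, Finset.mem_coe.mpr (Finset.mem_filter.mpr ⟨Finset.mem_univ _, he⟩), rfl⟩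
  obtain ⟨E, ⟨hE, s, hs, hsE⟩, hEmin⟩ := wellFounded_lt.has_min good hgood
  have hmin : ∀ a : E → MvPolynomial (Fin n) K,
      ∑ e, a e • monomialSyzygy K u e.1 = 0 → ∀ e, a e ∈ m := by
    intro a ha e₀
    by_contra hae
    refine hEmin (E.erase e₀) ⟨fun e he => hE e (Finset.mem_of_mem_erase he), a e₀ * s, ?_, ?_⟩
      (Finset.erase_ssubset e₀.2)
    · intro h
      rcases (Ideal.IsMaximal.isPrime inferInstance : m.IsPrime).mem_or_mem h with h | h
      exacts [hae h, hs h]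
    · intro w hw
      rw [mul_smul]
      set T := Submodule.span (MvPolynomial (Fin n) K) (monomialSyzygy K u '' (E.erase e₀.1 : Finset _))
      have hTe : ∀ e : E, e ≠ e₀ → monomialSyzygy K u e.1 ∈ T := fun e he =>
        Submodule.subset_span ⟨e.1, Finset.mem_coe.mpr
          (Finset.mem_erase.mpr ⟨fun h => he (Subtype.ext h), e.2⟩), rfl⟩
      have h0 : a e₀ • monomialSyzygy K u e₀.1 ∈ T := by
        rw [← Finset.add_sum_erase _ _ (Finset.mem_univ e₀), add_eq_zero_iff_eq_neg] at ha
        rw [ha]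
        exact T.neg_mem (T.sum_mem fun e he => T.smul_mem _ (hTe e (Finset.ne_of_mem_erase he)))
      have h1 : ∀ y ∈ Submodule.span (MvPolynomial (Fin n) K) (monomialSyzygy K u '' E),
          a e₀ • y ∈ T := by
        intro y hy
        induction hy using Submodule.span_induction with
        | mem y hy =>
          obtain ⟨e, he, rfl⟩ := hy
          by_cases hee : (⟨e, he⟩ : E) = e₀
          · subst hee
            exact h0
          · exact T.smul_mem _ (hTe ⟨e, he⟩ hee)
        | zero => simp
        | add y z _ _ hy hz => rw [smul_add]; exact T.add_mem hy hz
        | smul r y _ hy => rw [smul_comm]; exact T.smul_mem _ hy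
      exact h1 _ (hsE w hw)
  have himage : (Set.range fun e : E => monomialSyzygy K u e.1) = monomialSyzygy K u '' E := by
    ext; simp
  have hli := linearIndependent_of_subsingleton_ext hdim hR hpd (LinearMap.ker φ) hW
    (fun e : E => monomialSyzygy K u e.1) (fun e => hker _) hs
    (fun w hw => himage ▸ hsE w hw) hmin
  refine ⟨E, hE, ?_, fun z hz => ⟨s, hs, ?_⟩⟩
  · let g₀ : ι := Classical.arbitrary ι
    let v : Option E → ι → MvPolynomial (Fin n) K :=
      fun o => o.elim (Pi.single g₀ 1) (fun e => monomialSyzygy K u e.1)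
    have hv : LinearIndependent (MvPolynomial (Fin n) K) v := by
      rw [Fintype.linearIndependent_iff]
      intro a ha
      rw [Fintype.sum_option] at ha
      have h1 := congrArg φ ha
      rw [map_add, map_sum, map_zero] at h1
      have h2 : ∑ e : E, φ (a (some e) • v (some e)) = 0 :=
        Finset.sum_eq_zero fun e _ => by
          rw [map_smul, show v (some e) = monomialSyzygy K u e.1 from rfl,
            LinearMap.mem_ker.mp (hker e.1), smul_zero]
      have h3 : φ (v none) = monomial (u g₀) 1 := by
        rw [hφ]
        simp [v, Pi.single_apply]
      have h4 : a none = 0 := by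
        rw [h2, add_zero, map_smul, h3, smul_eq_mul, mul_eq_zero] at h1
        exact h1.resolve_right (by simp)
      rw [h4, zero_smul, zero_add] at ha
      rintro (_ | e)
      · exact h4
      · exact Fintype.linearIndependent_iff.mp hli (fun e => a (some e)) ha e
    have := hv.fintype_card_le_finrank
    rw [Module.finrank_fintype_fun_eq_card, Fintype.card_option, Fintype.card_coe] at this
    omega
  · have h1 := hsE z (LinearMap.mem_ker.mpr ((hφ z).trans hz))
    rw [Submodule.mem_span_image_finset_iff_exists_fun] at h1
    obtain ⟨a, ha⟩ := h1
    refine ⟨fun e => if h : e ∈ E then a ⟨e, h⟩ else 0, ha.symm.trans ?_⟩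
    rw [← Finset.sum_coe_sort E]
    exact Finset.sum_congr rfl fun e _ => by simp only [dif_pos e.2, Subtype.coe_eta]

/-- Ideals from which the unit ideal is reached by successively adjoining elements whose colon
ideal is generated by two distinct variables. -/
inductive PairFiltered {K : Type*} [Field K] {n : ℕ} : Ideal (MvPolynomial (Fin n) K) → Prop
  | top : PairFiltered ⊤
  | step (I : Ideal (MvPolynomial (Fin n) K)) (a : MvPolynomial (Fin n) K) (i j : Fin n)
      (hij : i ≠ j) (hcolon : ∀ f, f * a ∈ I ↔ f ∈ Ideal.span {X i, X j})
      (h : PairFiltered (I ⊔ Ideal.span {a})) : PairFiltered I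

section

namespace PairFiltered

lemma of_colon {J : Ideal (MvPolynomial (Fin n) K)} (hJ : PairFiltered J) :
    ∀ (I : Ideal (MvPolynomial (Fin n) K)) (a : MvPolynomial (Fin n) K),
      (∀ f, f * a ∈ I ↔ f ∈ J) → PairFiltered (I ⊔ Ideal.span {a}) → PairFiltered I := by
  induction hJ with
  | top =>
    intro I a h hI
    have : a ∈ I := by simpa using (h 1).mpr trivial
    rwa [sup_eq_left.mpr ((Ideal.span_singleton_le_iff_mem I).mpr this)] at hI
  | step J b i j hij hcolon _ ih =>
    intro I a h hI
    refine step I (a * b) i j hij (fun f => ?_) (ih _ a (fun f => ?_) ?_)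
    · rw [← hcolon, ← h]
      ring_nf
    · simp only [Submodule.mem_sup, Ideal.mem_span_singleton']
      constructor
      · rintro ⟨x, hx, _, ⟨c, rfl⟩, hf⟩
        refine ⟨f - c * b, (h _).mp ?_, c * b, ⟨c, rfl⟩, by ring⟩
        convert hx using 1
        linear_combination -hf
      · rintro ⟨x, hx, _, ⟨c, rfl⟩, rfl⟩
        exact ⟨x * a, (h x).mpr hx, c * (a * b), ⟨c, rfl⟩, by ring⟩
    · rw [sup_assoc, sup_eq_right.mpr (Ideal.span_singleton_le_span_singleton.mpr ⟨b, rfl⟩)]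
      exact hI

lemma exists_mem_not_dvd {J : Ideal (MvPolynomial (Fin n) K)} (hJ : PairFiltered J)
    {π : MvPolynomial (Fin n) K} (hπ : Prime π) : ∃ f ∈ J, ¬ π ∣ f := by
  induction hJ with
  | top => exact ⟨1, trivial, hπ.not_dvd_one⟩
  | step J b i j hij hcolon _ ih =>
    obtain ⟨f, hf, hfπ⟩ := ih
    have : ∃ p ∈ Ideal.span {(X i : MvPolynomial (Fin n) K), X j}, ¬ π ∣ p := by
      by_contra! h
      have hi := h (X i) (Ideal.subset_span (by simp))
      have hj := h (X j) (Ideal.subset_span (by simp))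
      have := (hπ.associated_of_dvd (X_prime (i := i)) hi).symm.dvd.trans hj
      exact hij (X_dvd_X.mp this)
    obtain ⟨p, hp, hpπ⟩ := this
    obtain ⟨x, hx, y, hy, rfl⟩ := Submodule.mem_sup.mp hf
    obtain ⟨c, rfl⟩ := Ideal.mem_span_singleton'.mp hy
    refine ⟨p * (x + c * b), ?_, hπ.not_dvd_mul hpπ hfπ⟩
    have : p * (x + c * b) = p * x + c * (p * b) := by ring
    rw [this]
    exact J.add_mem (J.mul_mem_left _ hx) (J.mul_mem_left _ ((hcolon p).mpr hp))

lemma span_mul_sup {J : Ideal (MvPolynomial (Fin n) K)} (hJ : PairFiltered J)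
    {g v : MvPolynomial (Fin n) K} (hv : v ∈ J) (hgv : IsRelPrime v g)
    (h : PairFiltered (Ideal.span {g, v})) :
    PairFiltered (Ideal.span {g} * J ⊔ Ideal.span {v}) := by
  refine hJ.of_colon _ g (fun f => ?_) ?_
  · simp only [Submodule.mem_sup, Ideal.mem_span_singleton_mul, Ideal.mem_span_singleton']
    constructor
    · rintro ⟨_, ⟨y, hy, rfl⟩, _, ⟨c, rfl⟩, hf⟩
      obtain ⟨d, hd⟩ : v ∣ f - y := hgv.dvd_of_dvd_mul_left ⟨c, by linear_combination -hf⟩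
      rw [show f = y + d * v by linear_combination hd]
      exact J.add_mem hy (J.mul_mem_left _ hv)
    · intro hf
      exact ⟨g * f, ⟨f, hf, rfl⟩, 0, ⟨0, by simp⟩, by ring⟩
  · convert h using 1
    have : Ideal.span {g} * J ⊔ Ideal.span {g} = Ideal.span {g} := sup_eq_right.mpr Ideal.mul_le_left
    rw [sup_right_comm, this, Ideal.span_insert]

end PairFiltered

lemma finsupp_nat_induction {α : Type*} {p : (α →₀ ℕ) → Prop} (d : α →₀ ℕ) (zero : p 0)
    (add_single : ∀ i d, p d → p (Finsupp.single i 1 + d)) : p d := by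
  suffices h : ∀ d e : α →₀ ℕ, p e → p (d + e) by simpa using h d 0 zero
  intro d
  induction d using Finsupp.induction_linear with
  | zero => simp
  | add f g hf hg => intro e he; rw [add_assoc]; exact hf _ (hg _ he)
  | single i k =>
    induction k with
    | zero => simp
    | succ k ih =>
      intro e he
      rw [add_comm k 1, Finsupp.single_add, add_assoc]
      exact add_single _ _ (ih e he)

lemma isRelPrime_monomial {d : Fin n →₀ ℕ} {s : MvPolynomial (Fin n) K}
    (h : ∀ i, d i ≠ 0 → ¬ X i ∣ s) : IsRelPrime (monomial d 1) s := by
  induction d using finsupp_nat_induction with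
  | zero => exact isRelPrime_one_left
  | add_single i d ih =>
    rw [← mul_one (1 : K), ← monomial_mul]
    refine IsRelPrime.mul_left ?_ (ih fun j hj => h j (by simp [hj]))
    exact ((X_prime (i := i)).irreducible.isRelPrime_iff_not_dvd).mpr (h i (by simp))

lemma isRelPrime_monomial_monomial {d e : Fin n →₀ ℕ} (h : d ⊓ e = 0) :
    IsRelPrime (monomial d (1 : K)) (monomial e 1) := by
  refine isRelPrime_monomial fun i hi => ?_
  have := DFunLike.congr_fun h i
  simp at this
  simp [X_dvd_monomial]
  omega

lemma span_pair_mul_left {R : Type*} [CommRing R] (p g v : R) :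
    Ideal.span {p * g, v} = Ideal.span {p} * Ideal.span {g, v} ⊔ Ideal.span {v} := by
  rw [Ideal.span_insert, Ideal.span_insert, Ideal.mul_sup, Ideal.span_singleton_mul_span_singleton,
    sup_assoc]
  exact congrArg _ (sup_eq_right.mpr Ideal.mul_le_right).symm

lemma pairFiltered_span_X_X {i j : Fin n} (hij : i ≠ j) :
    PairFiltered (Ideal.span {(X i : MvPolynomial (Fin n) K), X j}) := by
  refine .step _ 1 i j hij (by simp) ?_
  rw [Ideal.span_singleton_one, sup_top_eq]
  exact .top

lemma pairFiltered_span_X_monomial {i : Fin n} {e : Fin n →₀ ℕ} (h : e i = 0) :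
    PairFiltered (Ideal.span {(X i : MvPolynomial (Fin n) K), monomial e 1}) := by
  induction e using finsupp_nat_induction with
  | zero =>
    rw [Ideal.eq_top_of_isUnit_mem (Ideal.span _) (Ideal.subset_span (by simp)) isUnit_one]
    exact .top
  | add_single j e ih =>
    have hij : j ≠ i := by rintro rfl; simp at h
    have he : e i = 0 := by simp at h; omega
    have := (ih he).span_mul_sup (g := X j) (v := X i) (Ideal.subset_span (by simp))
      (((X_prime (i := i)).irreducible.isRelPrime_iff_not_dvd).mpr (by simpa [X_dvd_X] using hij.symm))
      (pairFiltered_span_X_X hij)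
    rw [Ideal.span_pair_comm (x := X i), ← span_pair_mul_left, X, monomial_mul, mul_one] at this
    rwa [Ideal.span_pair_comm]

lemma pairFiltered_span_monomial_monomial {d e : Fin n →₀ ℕ} (h : d ⊓ e = 0) :
    PairFiltered (Ideal.span {(monomial d 1 : MvPolynomial (Fin n) K), monomial e 1}) := by
  induction d using finsupp_nat_induction with
  | zero =>
    rw [Ideal.eq_top_of_isUnit_mem (Ideal.span _) (Ideal.subset_span (by simp)) isUnit_one]
    exact .top
  | add_single i d ih =>
    have hi : e i = 0 := by
      have := DFunLike.congr_fun h i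
      simp at this
      omega
    have hd : d ⊓ e = 0 := by
      ext j
      have := DFunLike.congr_fun h j
      simp at this ⊢
      omega
    have := (ih hd).span_mul_sup (g := X i) (v := monomial e 1) (Ideal.subset_span (by simp))
      (isRelPrime_monomial fun j hj hji => hj (X_dvd_X (R := K).mp hji ▸ hi))
      (pairFiltered_span_X_monomial hi)
    rwa [← span_pair_mul_left, X, monomial_mul, mul_one] at this

lemma nonempty_map_mkQ_equiv_quotient {R : Type*} [CommRing R] {I P : Ideal R} {a : R}
    (h : ∀ f, f * a ∈ I ↔ f ∈ P) :
    Nonempty (↥(Submodule.map I.mkQ (I ⊔ Ideal.span {a})) ≃ₗ[R] (R ⧸ P)) := by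
  let φ : R →ₗ[R] R ⧸ I := LinearMap.toSpanSingleton R (R ⧸ I) (I.mkQ a)
  have hker : LinearMap.ker φ = P := by
    ext f
    rw [LinearMap.mem_ker, ← h, LinearMap.toSpanSingleton_apply, ← map_smul, smul_eq_mul,
      Submodule.mkQ_apply, Submodule.Quotient.mk_eq_zero]
  have hrange : LinearMap.range φ = Submodule.map I.mkQ (I ⊔ Ideal.span {a}) := by
    rw [Submodule.map_sup, Submodule.mkQ_map_self, bot_sup_eq, LinearMap.range_toSpanSingleton,
      Ideal.span, Submodule.map_span, Set.image_singleton]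
  exact ⟨(LinearEquiv.ofEq _ _ hrange.symm).trans
    (φ.quotKerEquivRange.symm.trans (Submodule.quotEquivOfEq _ _ hker))⟩

lemma PairFiltered.exists_isPrimeFiltration {I : Ideal (MvPolynomial (Fin n) K)}
    (hI : PairFiltered I) :
    ∃ (r : ℕ) (F : Fin (r + 1) → Ideal (MvPolynomial (Fin n) K))
      (P : Fin r → Ideal (MvPolynomial (Fin n) K)), IsPrimeFiltration I r F P ∧
        ∀ k, ∃ i j, i ≠ j ∧ P k = Ideal.span {X i, X j} ∧ I ≤ P k := by
  induction hI with
  | top => exact ⟨0, fun _ => ⊤, Fin.elim0, ⟨rfl, rfl, fun k => k.elim0, fun k => k.elim0⟩,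
      fun k => k.elim0⟩
  | step I a i j hij hcolon _ ih =>
    obtain ⟨r, F, P, ⟨hF0, hFl, hFm, hFP⟩, hP⟩ := ih
    have hprime : (Ideal.span {(X i : MvPolynomial (Fin n) K), X j}).IsPrime := by
      rw [← Set.image_pair]
      exact isPrime_span_X_image _
    refine ⟨r + 1, Fin.cons I F, Fin.cons (Ideal.span {X i, X j}) P,
      ⟨rfl, by rw [← Fin.succ_last, Fin.cons_succ, hFl], ?_, ?_⟩, ?_⟩
    · refine Fin.cases ?_ fun k => ?_
      · rw [Fin.castSucc_zero, Fin.cons_zero, Fin.cons_succ, hF0]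
        exact le_sup_left
      · rw [Fin.castSucc_succ, Fin.cons_succ, Fin.cons_succ]
        exact hFm k
    · refine Fin.cases ?_ fun k => ?_
      · rw [Fin.castSucc_zero, Fin.cons_zero, Fin.cons_succ, Fin.cons_zero, hF0]
        exact ⟨hprime, nonempty_map_mkQ_equiv_quotient hcolon⟩
      · rw [Fin.castSucc_succ, Fin.cons_succ, Fin.cons_succ, Fin.cons_succ]
        exact hFP k
    · refine Fin.cases ?_ fun k => ?_
      · exact ⟨i, j, hij, rfl, fun f hf => (hcolon f).mp (I.mul_mem_right _ hf)⟩
      · obtain ⟨i', j', hij', h1, h2⟩ := hP k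
        exact ⟨i', j', hij', h1, le_sup_left.trans h2⟩

end

section

lemma PairFiltered.exists_span_mul_sup {J : Ideal (MvPolynomial (Fin n) K)} (hJ : PairFiltered J)
    {h c b : Fin n →₀ ℕ}
    (hb : monomial b 1 * monomial c 1 ∈ Ideal.span {monomial h (1 : K)} * J)
    (hdvd : ∀ f, f * monomial c 1 ∈ Ideal.span {monomial h (1 : K)} * J → monomial b 1 ∣ f) :
    ∃ (h' : Fin n →₀ ℕ) (J' : Ideal (MvPolynomial (Fin n) K)), PairFiltered J' ∧
      Ideal.span {monomial h 1} * J ⊔ Ideal.span {monomial c 1} = Ideal.span {monomial h' 1} * J' := by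
  set p := h ⊓ c
  set g := h - p
  set v := c - p
  have hpg : monomial h (1 : K) = monomial p 1 * monomial g 1 := by
    rw [monomial_mul, mul_one, add_tsub_cancel_of_le inf_le_left]
  have hpv : monomial c (1 : K) = monomial p 1 * monomial v 1 := by
    rw [monomial_mul, mul_one, add_tsub_cancel_of_le inf_le_right]
  have hgv : g ⊓ v = 0 := by
    ext i
    simp [g, v, p]
    omega
  have hbg : b ≤ g := by
    by_contra hbg
    obtain ⟨i, hi⟩ : ∃ i, ¬ b i ≤ g i := by simpa [Finsupp.le_def] using hbg
    obtain ⟨f, hf, hfi⟩ := hJ.exists_mem_not_dvd (X_prime (R := K) (i := i))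
    have h1 : monomial b 1 ∣ monomial g 1 * f := hdvd _ <| by
      rw [Ideal.mem_span_singleton_mul]
      refine ⟨monomial v 1 * f, J.mul_mem_left _ hf, ?_⟩
      rw [hpg, hpv]
      ring
    have hbm : monomial b (1 : K) = monomial (b ⊓ g) 1 * monomial (b - b ⊓ g) 1 := by
      rw [monomial_mul, mul_one, add_tsub_cancel_of_le inf_le_left]
    have hgm : monomial g (1 : K) = monomial (b ⊓ g) 1 * monomial (g - b ⊓ g) 1 := by
      rw [monomial_mul, mul_one, add_tsub_cancel_of_le inf_le_right]
    rw [hbm, hgm, mul_assoc] at h1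
    have h2 := (mul_dvd_mul_iff_left (by simp)).mp h1
    have h3 : IsRelPrime (monomial (b - b ⊓ g) (1 : K)) (monomial (g - b ⊓ g) 1) :=
      isRelPrime_monomial_monomial (by ext j; simp; omega)
    refine hfi (dvd_trans ?_ (h3.dvd_of_dvd_mul_left h2))
    rw [X_dvd_monomial]
    right
    simp
    omega
  have hv : monomial v 1 ∈ J := by
    have h1 : monomial (g - b) 1 * (monomial b 1 * monomial c 1) ∈
        Ideal.span {monomial h (1 : K)} * J := Ideal.mul_mem_left _ _ hb
    rw [← mul_assoc, monomial_mul, tsub_add_cancel_of_le hbg, mul_one, hpv,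
      Ideal.mem_span_singleton_mul] at h1
    obtain ⟨f, hf, hfe⟩ := h1
    have h2 : monomial h 1 * f = monomial h 1 * monomial v 1 := by
      rw [hfe, hpg]
      ring
    rwa [← mul_left_cancel₀ (by simp) h2]
  refine ⟨p, Ideal.span {monomial g 1} * J ⊔ Ideal.span {monomial v 1},
    hJ.span_mul_sup hv (isRelPrime_monomial_monomial hgv).symm
      (pairFiltered_span_monomial_monomial hgv), ?_⟩
  rw [Ideal.mul_sup, ← mul_assoc, Ideal.span_singleton_mul_span_singleton,
    Ideal.span_singleton_mul_span_singleton, ← hpg, ← hpv]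

lemma exists_card_filter_incident_le_one {ι : Type*} [DecidableEq ι] (A : Finset ι)
    (E : Finset (ι × ι)) (hcard : E.card < A.card) :
    ∃ c ∈ A, (E.filter fun e => e.1 = c ∨ e.2 = c).card ≤ 1 := by
  by_contra! h
  have h1 : A.card * 2 ≤ ∑ c ∈ A, (E.filter fun e => e.1 = c ∨ e.2 = c).card :=
    Finset.card_nsmul_le_sum A _ 2 h
  have h2 : ∑ c ∈ A, (E.filter fun e => e.1 = c ∨ e.2 = c).card =
      ∑ e ∈ E, (A.filter fun c => e.1 = c ∨ e.2 = c).card :=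
    Finset.sum_card_bipartiteAbove_eq_sum_card_bipartiteBelow
      (fun (c : ι) (e : ι × ι) => e.1 = c ∨ e.2 = c)
  have h3 : ∑ e ∈ E, (A.filter fun c => e.1 = c ∨ e.2 = c).card ≤ E.card * 2 := by
    refine Finset.sum_le_card_nsmul _ _ _ fun e _ => ?_
    refine (Finset.card_le_card (t := {e.1, e.2}) fun c hc => ?_).trans Finset.card_le_two
    simp only [Finset.mem_filter] at hc
    simpa [eq_comm] using hc.2
  omega

lemma exists_sum_eq_of_mem_span_image {R ι : Type*} [CommRing R] [Fintype ι] [DecidableEq ι]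
    {v : ι → R} {A : Finset ι} {f : R} (hf : f ∈ Ideal.span (v '' A)) :
    ∃ y : ι → R, (∀ g ∉ A, y g = 0) ∧ ∑ g, y g * v g = f := by
  induction hf using Submodule.span_induction with
  | mem x hx =>
    obtain ⟨g, hg, rfl⟩ := hx
    exact ⟨Pi.single g 1, fun g' hg' => Pi.single_eq_of_ne (by rintro rfl; exact hg' hg) _,
      by simp [Pi.single_apply]⟩
  | zero => exact ⟨0, by simp, by simp⟩
  | add x y _ _ hx hy =>
    obtain ⟨a, ha, rfl⟩ := hx
    obtain ⟨b, hb, rfl⟩ := hy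
    exact ⟨a + b, fun g hg => by simp [ha g hg, hb g hg], by simp [add_mul, Finset.sum_add_distrib]⟩
  | smul r x _ hx =>
    obtain ⟨a, ha, rfl⟩ := hx
    exact ⟨r • a, fun g hg => by simp [ha g hg], by simp [Finset.mul_sum, mul_assoc]⟩

section
variable {ι : Type*} [DecidableEq ι] (u : ι → Fin n →₀ ℕ)

lemma monomialSyzygy_apply_of_ne {e : ι × ι} {g : ι} (h1 : e.1 ≠ g) (h2 : e.2 ≠ g) :
    monomialSyzygy K u e g = 0 := by
  simp [monomialSyzygy, h1.symm, h2.symm]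

lemma exists_monomialSyzygy_apply_of_incident {e : ι × ι} {c : ι} (he : e.1 ≠ e.2)
    (hc : e.1 = c ∨ e.2 = c) : ∃ d, (d = e.1 ∨ d = e.2) ∧ d ≠ c ∧
      ∃ ε : MvPolynomial (Fin n) K, ε * ε = 1 ∧
      monomialSyzygy K u e c = ε * monomial ((u c ⊔ u d) - u c) 1 := by
  rcases hc with rfl | rfl
  · exact ⟨e.2, .inr rfl, he.symm, 1, by simp, by simp [monomialSyzygy, he]⟩
  · exact ⟨e.1, .inl rfl, he, -1, by simp,
      by simp [monomialSyzygy, he.symm, sup_comm]⟩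

lemma exists_pairFiltered_of_card_lt [Fintype ι] (k : ℕ) :
    ∀ A : Finset ι, A.card = k + 1 → ∀ E : Finset (ι × ι),
      (∀ e ∈ E, e.1 ≠ e.2 ∧ e.1 ∈ A ∧ e.2 ∈ A) → E.card < A.card →
      (∀ z : ι → MvPolynomial (Fin n) K, (∀ g ∉ A, z g = 0) → ∑ g, z g * monomial (u g) 1 = 0 →
        ∃ s ∉ (Ideal.span (Set.range X) : Ideal (MvPolynomial (Fin n) K)),
          ∃ a : ι × ι → MvPolynomial (Fin n) K, s • z = ∑ e ∈ E, a e • monomialSyzygy K u e) →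
      ∃ (h : Fin n →₀ ℕ) (J : Ideal (MvPolynomial (Fin n) K)), PairFiltered J ∧
        Ideal.span ((fun g => monomial (u g) 1) '' A) = Ideal.span {monomial h 1} * J := by
  induction k with
  | zero =>
    intro A hA _ _ _ _
    obtain ⟨c, rfl⟩ := Finset.card_eq_one.mp hA
    exact ⟨u c, ⊤, .top, by simp⟩
  | succ k ih =>
    intro A hA E hE hcard hsyz
    obtain ⟨c, hcA, hc⟩ := exists_card_filter_incident_le_one A E hcard
    have happly : ∀ (a : ι × ι → MvPolynomial (Fin n) K) e, e ∈ E → ¬ (e.1 = c ∨ e.2 = c) →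
        (a e • monomialSyzygy K u e) c = 0 := by
      intro a e _ he
      push Not at he
      simp [monomialSyzygy_apply_of_ne u he.1 he.2]
    rcases Nat.le_one_iff_eq_zero_or_eq_one.mp hc with hc | hc
    · exfalso
      have hnone : ∀ e ∈ E, ¬ (e.1 = c ∨ e.2 = c) :=
        Finset.filter_eq_empty_iff.mp (Finset.card_eq_zero.mp hc)
      obtain ⟨d, hdA, hdc⟩ : ∃ d ∈ A, d ≠ c := by
        have : 1 < A.card := by omega
        exact Finset.exists_mem_ne this c
      obtain ⟨s, hs, a, ha⟩ := hsyz (monomialSyzygy K u (c, d))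
        (fun g hg => monomialSyzygy_apply_of_ne u (by rintro rfl; exact hg hcA)
          (by rintro rfl; exact hg hdA)) (sum_monomialSyzygy_mul u _)
      have h1 := congrFun ha c
      rw [Finset.sum_apply, Finset.sum_eq_zero fun e he => happly a e he (hnone e he)] at h1
      have h2 : s = 0 := by simpa [monomialSyzygy, hdc.symm] using h1
      exact hs (h2 ▸ Submodule.zero_mem _)
    · obtain ⟨e₀, he₀⟩ := Finset.card_eq_one.mp hc
      have he₀' : e₀ ∈ E ∧ (e₀.1 = c ∨ e₀.2 = c) := Finset.mem_filter.mp (he₀ ▸ Finset.mem_singleton_self e₀)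
      have hother : ∀ e ∈ E, e ≠ e₀ → ¬ (e.1 = c ∨ e.2 = c) := fun e he hne h =>
        hne (Finset.mem_singleton.mp (he₀ ▸ Finset.mem_filter.mpr ⟨he, h⟩))
      obtain ⟨hne, h1A, h2A⟩ := hE e₀ he₀'.1
      obtain ⟨d, hd, hdc, ε, hε, hσ⟩ :=
        exists_monomialSyzygy_apply_of_incident (K := K) u hne he₀'.2
      have hdA : d ∈ A.erase c := Finset.mem_erase.mpr ⟨hdc, by rcases hd with rfl | rfl <;> assumption⟩
      have hsum : ∀ a : ι × ι → MvPolynomial (Fin n) K, (∑ e ∈ E, a e • monomialSyzygy K u e) c =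
          a e₀ * (ε * monomial ((u c ⊔ u d) - u c) 1) := by
        intro a
        rw [Finset.sum_apply, Finset.sum_eq_single_of_mem e₀ he₀'.1 fun e he hne =>
          happly a e he (hother e he hne)]
        simp [hσ]
      have hA' : (A.erase c).card = k + 1 := by rw [Finset.card_erase_of_mem hcA, hA]; rfl
      have hE' : (E.erase e₀).card = E.card - 1 := Finset.card_erase_of_mem he₀'.1
      have hEpos : 0 < E.card := Finset.card_pos.mpr ⟨e₀, he₀'.1⟩
      obtain ⟨h, J, hJ, hJe⟩ := ih (A.erase c) hA' (E.erase e₀) (fun e he => by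
          obtain ⟨hne', heE⟩ := Finset.mem_erase.mp he
          have h1 := hother e heE hne'
          push Not at h1
          obtain ⟨h2, h3, h4⟩ := hE e heE
          exact ⟨h2, Finset.mem_erase.mpr ⟨h1.1, h3⟩, Finset.mem_erase.mpr ⟨h1.2, h4⟩⟩)
        (by omega) (fun z hz hz0 => by
          obtain ⟨s, hs, a, ha⟩ := hsyz z
            (fun g hg => hz g fun h => hg (Finset.mem_of_mem_erase h)) hz0
          refine ⟨s, hs, a, ha.trans ?_⟩
          have h1 := congrFun ha c
          rw [hsum, Pi.smul_apply, hz c (Finset.notMem_erase c A), smul_zero] at h1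
          have hε0 : ε ≠ 0 := by rintro rfl; simp at hε
          have h2 : a e₀ = 0 := (mul_eq_zero.mp h1.symm).resolve_right
            (mul_ne_zero hε0 (by simp))
          rw [← Finset.add_sum_erase _ _ he₀'.1, h2, zero_smul, zero_add])
      have hspan : Ideal.span ((fun g => monomial (u g) (1 : K)) '' A) =
          Ideal.span {monomial h 1} * J ⊔ Ideal.span {monomial (u c) 1} := by
        rw [← hJe, ← Ideal.span_union, ← Finset.insert_erase hcA]
        congr 1
        rw [Finset.coe_insert, Set.image_insert_eq, Finset.erase_insert (Finset.notMem_erase c A),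
          Set.union_singleton]
      rw [hspan]
      refine hJ.exists_span_mul_sup (b := (u c ⊔ u d) - u c) ?_ fun f hf => ?_
      · have h1 : (monomial ((u c ⊔ u d) - u c) 1 * monomial (u c) 1 : MvPolynomial (Fin n) K) =
            monomial ((u c ⊔ u d) - u d) 1 * monomial (u d) 1 := by
          rw [monomial_mul, monomial_mul, tsub_add_cancel_of_le le_sup_left,
            tsub_add_cancel_of_le le_sup_right]
        rw [← hJe, h1]
        exact Ideal.mul_mem_left _ _ (Ideal.subset_span ⟨d, hdA, rfl⟩)
      · rw [← hJe] at hf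
        obtain ⟨y, hy, hyf⟩ := exists_sum_eq_of_mem_span_image hf
        obtain ⟨s, hs, a, ha⟩ := hsyz (Pi.single c f - y) (fun g hg => by
          rw [Pi.sub_apply, hy g fun h => hg (Finset.mem_of_mem_erase h), sub_zero]
          exact Pi.single_eq_of_ne (by rintro rfl; exact hg hcA) _) (by
          simp [sub_mul, Finset.sum_sub_distrib, hyf, Pi.single_apply])
        have h1 := congrFun ha c
        rw [hsum, Pi.smul_apply, Pi.sub_apply, Pi.single_eq_same, hy c (Finset.notMem_erase c A),
          sub_zero, smul_eq_mul] at h1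
        refine (isRelPrime_monomial fun i _ hi => hs ?_).dvd_of_dvd_mul_left
          (⟨a e₀ * ε, by rw [h1]; ring⟩ : _ ∣ s * f)
        obtain ⟨t, rfl⟩ := hi
        exact Ideal.mul_mem_right _ _ (Ideal.subset_span ⟨i, rfl⟩)

end

end

section Height

lemma card_le_height_span_X_image {σ : Type*} [DecidableEq σ] (s : Finset σ) :
    (s.card : ℕ∞) ≤ (Ideal.span (X '' (s : Set σ) : Set (MvPolynomial σ K))).height := by
  induction s using Finset.induction_on with
  | empty => simp
  | insert a s ha ih =>
    have h1 := isPrime_span_X_image (R := K) (s : Set σ)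
    have h2 := isPrime_span_X_image (R := K) ((insert a s : Finset σ) : Set σ)
    have hlt : Ideal.span (X '' (s : Set σ) : Set (MvPolynomial σ K)) <
        Ideal.span (X '' ((insert a s : Finset σ) : Set σ)) := by
      refine lt_of_le_not_ge (Ideal.span_mono (Set.image_mono (by simp))) fun h => ?_
      have h3 : (X a : MvPolynomial σ K) ∈ Ideal.span (X '' (s : Set σ)) :=
        h (X_mem_span_X_image.2 (by simp))
      exact ha (by simpa using X_mem_span_X_image.1 h3)
    rw [Finset.card_insert_of_notMem ha]
    rw [Nat.cast_succ]
    exact (add_le_add_left ih 1).trans (Ideal.height_add_one_le_of_lt_of_isPrime hlt)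

lemma exists_X_mem_of_monomial_mem {σ : Type*} {q : Ideal (MvPolynomial σ K)} [hq : q.IsPrime]
    {d : σ →₀ ℕ} (hd : monomial d 1 ∈ q) : ∃ i, d i ≠ 0 ∧ X i ∈ q := by
  rw [monomial_eq, map_one, one_mul, Finsupp.prod, hq.prod_mem_iff] at hd
  obtain ⟨i, hi, h⟩ := hd
  exact ⟨i, Finsupp.mem_support_iff.1 hi, hq.mem_of_pow_mem _ h⟩

lemma monomial_mem_of_X_mem {σ : Type*} {I : Ideal (MvPolynomial σ K)} {d : σ →₀ ℕ} {i : σ}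
    (hd : d i ≠ 0) (hi : X i ∈ I) : monomial d 1 ∈ I :=
  I.mem_of_dvd (X_dvd_monomial.2 (Or.inr hd)) hi

lemma le_ringKrullDim_quotient_add_height {I q : Ideal (MvPolynomial (Fin n) K)} [hq : q.IsPrime]
    {A : Set (Fin n →₀ ℕ)} (hI : I = Ideal.span ((fun d => monomial d 1) '' A)) (hIq : I ≤ q) :
    (n : WithBot ℕ∞) ≤ ringKrullDim (MvPolynomial (Fin n) K ⧸ I) + (q.height : WithBot ℕ∞) := by
  classical
  let B : Finset (Fin n) := Finset.univ.filter fun i => X i ∈ q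
  let p : Ideal (MvPolynomial (Fin n) K) := Ideal.span (X '' (B : Set (Fin n)))
  have hIp : I ≤ p := by
    rw [hI, Ideal.span_le]
    rintro _ ⟨d, hd, rfl⟩
    have : monomial d 1 ∈ q := hIq (hI ▸ Ideal.subset_span ⟨d, hd, rfl⟩)
    obtain ⟨i, hi, hiq⟩ := exists_X_mem_of_monomial_mem this
    exact monomial_mem_of_X_mem hi (X_mem_span_X_image.2 (by simpa [B] using hiq))
  have hpq : p ≤ q := by
    rw [Ideal.span_le]
    rintro _ ⟨i, hi, rfl⟩
    simpa [B] using hi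
  have hB : (B.card : ℕ∞) ≤ q.height :=
    (card_le_height_span_X_image B).trans (Ideal.height_mono hpq)
  let m : Ideal (MvPolynomial (Fin n) K) := Ideal.span (X '' ((Finset.univ : Finset (Fin n)) : Set _))
  have hm : m.IsPrime := isPrime_span_X_image _
  have h1 : (n : ℕ∞) ≤ m.height := by
    simpa [m] using card_le_height_span_X_image (K := K) (Finset.univ : Finset (Fin n))
  have h2 := Ideal.height_le_ringKrullDim_quotient_add_encard (p := m)
    (X '' (B : Set (Fin n))) ((Set.image_mono (by simp)).trans Ideal.subset_span)
  have h3 : (X '' (B : Set (Fin n)) : Set (MvPolynomial (Fin n) K)).encard ≤ q.height := by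
    refine (Set.encard_image_le _ _).trans ?_
    simpa using hB
  have h4 : ringKrullDim (MvPolynomial (Fin n) K ⧸ p) ≤ ringKrullDim (MvPolynomial (Fin n) K ⧸ I) :=
    ringKrullDim_le_of_surjective (Ideal.Quotient.factor hIp) (Ideal.Quotient.factor_surjective hIp)
  calc (n : WithBot ℕ∞) ≤ (m.height : WithBot ℕ∞) := by exact_mod_cast h1
    _ ≤ _ := h2
    _ ≤ _ := add_le_add h4 (by exact_mod_cast h3)

lemma IsMonomialIdeal.exists_finset {I : Ideal (MvPolynomial (Fin n) K)} (hI : IsMonomialIdeal I) :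
    ∃ A : Finset (Fin n →₀ ℕ), I = Ideal.span ((fun d => monomial d 1) '' (A : Set _)) := by
  classical
  obtain ⟨G, hG, rfl⟩ := hI
  obtain ⟨t, htG, ht⟩ := (Submodule.fg_span_iff_fg_span_finset_subset G).1
    ((isNoetherianRing_iff_ideal_fg _).1 inferInstance (Ideal.span G))
  have : (t : Set _) ⊆ (fun d : Fin n →₀ ℕ => monomial d (1 : K)) '' Set.univ := fun g hg => by
    obtain ⟨e, he⟩ := hG g (htG hg)
    exact ⟨e, trivial, he.symm⟩
  obtain ⟨A, -, rfl⟩ := Finset.subset_set_image_iff.1 this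
  exact ⟨A, by rw [← Finset.coe_image]; exact ht⟩

lemma exists_isRegular_of_le_mDepth {S : Type*} [CommRing S] {m : Ideal S} {M : Type*} [AddCommGroup M]
    [Module S M] [Nontrivial M] {k : ℕ} (h : (k : ℕ∞) ≤ mDepth S m M) :
    ∃ rs : List S, (∀ r ∈ rs, r ∈ m) ∧ RingTheory.Sequence.IsRegular M rs ∧ k ≤ rs.length := by
  by_contra! hc
  have h0 := hc [] (by simp) (RingTheory.Sequence.IsRegular.nil S M)
  obtain ⟨l, rfl⟩ : ∃ l, k = l + 1 := ⟨k - 1, by simp at h0; omega⟩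
  have : mDepth S m M ≤ (l : ℕ∞) := by
    refine sSup_le ?_
    rintro _ ⟨rs, rfl, hrs, hreg⟩
    have := hc rs hrs hreg
    exact_mod_cast (by omega : rs.length ≤ l)
  have := h.trans this
  norm_cast at this
  omega

lemma idealHeight_le_height {S : Type*} [CommRing S] {I q : Ideal S} [q.IsPrime] (h : I ≤ q) :
    idealHeight I ≤ q.height :=
  sInf_le ⟨⟨q, inferInstance⟩, h, (PrimeSpectrum.height_eq_orderHeight _).symm⟩

lemma exists_isPrime_height_eq_idealHeight {S : Type*} [CommRing S] {I : Ideal S}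
    (h : idealHeight I ≠ ⊤) : ∃ q : Ideal S, q.IsPrime ∧ I ≤ q ∧ q.height = idealHeight I := by
  have hne : {k : ℕ∞ | ∃ q : PrimeSpectrum S, I ≤ q.asIdeal ∧ Order.height q = k}.Nonempty := by
    by_contra hc
    rw [Set.not_nonempty_iff_eq_empty] at hc
    exact h (by rw [idealHeight, hc, sInf_empty])
  obtain ⟨q, hq, hq'⟩ := csInf_mem hne
  exact ⟨q.asIdeal, q.2, hq, (PrimeSpectrum.height_eq_orderHeight q).trans hq'⟩

lemma not_le_span_singleton_X {I : Ideal (MvPolynomial (Fin n) K)} (h : 1 < idealHeight I)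
    (i : Fin n) : ¬ I ≤ Ideal.span {X i} := fun hI => by
  have hp : (Ideal.span {(X i : MvPolynomial (Fin n) K)}).IsPrime :=
    (Ideal.span_singleton_prime (X_ne_zero i)).2 X_prime
  refine absurd (h.trans_le (idealHeight_le_height hI)) (not_lt.2 ?_)
  refine Ideal.height_le_one_of_isPrincipal_of_mem_minimalPrimes (Ideal.span {X i}) _ ?_
  rw [Ideal.minimalPrimes_eq_subsingleton_self]
  rfl

lemma mem_minimalPrimes_of_isMonomialIdeal {I : Ideal (MvPolynomial (Fin n) K)}
    {A : Set (Fin n →₀ ℕ)} (hI : I = Ideal.span ((fun d => monomial d 1) '' A))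
    (hX : ∀ i, ¬ I ≤ Ideal.span {X i}) {i j : Fin n}
    (hle : I ≤ Ideal.span {X i, X j}) : Ideal.span {X i, X j} ∈ I.minimalPrimes := by
  have himg : ∀ i j : Fin n, Ideal.span {(X i : MvPolynomial (Fin n) K), X j} =
      Ideal.span (X '' {i, j}) := fun i j => by rw [Set.image_pair]
  have key : ∀ Q : Ideal (MvPolynomial (Fin n) K), Q.IsPrime → I ≤ Q → ∀ i j : Fin n,
      Q ≤ Ideal.span {X i, X j} → X j ∈ Q := by
    intro Q hQ hIQ i j hQP
    obtain ⟨d, hd, hdi⟩ : ∃ d ∈ A, monomial d 1 ∉ Ideal.span {(X i : MvPolynomial (Fin n) K)} := by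
      by_contra! hc
      refine hX i ?_
      rw [hI, Ideal.span_le]
      rintro _ ⟨d, hd, rfl⟩
      exact hc d hd
    have hdQ : monomial d 1 ∈ Q := hIQ (hI ▸ Ideal.subset_span ⟨d, hd, rfl⟩)
    obtain ⟨l, hl, hlQ⟩ := exists_X_mem_of_monomial_mem hdQ
    have hlP := hQP hlQ
    rw [himg, X_mem_span_X_image] at hlP
    rcases hlP with rfl | rfl
    · exact absurd (monomial_mem_of_X_mem hl (Ideal.mem_span_singleton_self _)) hdi
    · exact hlQ
  refine ⟨⟨by rw [himg]; exact isPrime_span_X_image _, hle⟩, fun Q hQ hQP => ?_⟩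
  rw [Ideal.span_le, Set.insert_subset_iff, Set.singleton_subset_iff]
  exact ⟨key Q hQ.1 hQ.2 j i (by rwa [Set.pair_comm]), key Q hQ.1 hQ.2 i j hQP⟩

end Height

/-- If `I ⊆ K[x₁,…,xₙ]` is a monomial ideal of height two such
that `S/I` is Cohen–Macaulay, then `S/I` is clean. -/
theorem stmt_2 (I : Ideal Sn) (hI : IsMonomialIdeal I)
    (hht : idealHeight I = 2) (hCM : IsCM Sn mn (Sn ⧸ I)) :
    IsClean I := by
  classical
  obtain ⟨A, hA⟩ := hI.exists_finset
  obtain ⟨q, hq, hIq, hqh⟩ := exists_isPrime_height_eq_idealHeight (I := I) (by simp [hht])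
  have hX : ∀ i, ¬ I ≤ Ideal.span {X i} := not_le_span_singleton_X (by rw [hht]; norm_num)
  have hnontriv : Nontrivial (Sn ⧸ I) :=
    Ideal.Quotient.nontrivial_iff.2 (ne_top_of_le_ne_top hq.ne_top hIq)
  have hdepth : ((n - 2 : ℕ) : ℕ∞) ≤ mDepth Sn mn (Sn ⧸ I) := by
    have h := le_ringKrullDim_quotient_add_height hA hIq
    rw [hqh, hht] at h
    rw [IsCM, Ideal.annihilator_quotient] at hCM
    rw [← hCM] at h
    have h' : (n : ℕ∞) ≤ mDepth Sn mn (Sn ⧸ I) + 2 := by exact_mod_cast h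
    rw [ENat.natCast_sub]
    exact tsub_le_iff_right.2 h'
  obtain ⟨rs, hrs, hreg, hlen⟩ := exists_isRegular_of_le_mDepth hdepth
  have hIm : I ≤ mn := by
    rw [hA, Ideal.span_le]
    rintro _ ⟨d, hd, rfl⟩
    have : monomial d 1 ∈ q := hIq (hA ▸ Ideal.subset_span ⟨d, hd, rfl⟩)
    obtain ⟨i, hi, -⟩ := exists_X_mem_of_monomial_mem this
    exact monomial_mem_of_X_mem hi (Ideal.subset_span ⟨i, rfl⟩)
  have hne : Nonempty A := by
    by_contra hc
    rw [not_nonempty_iff, Finset.isEmpty_coe_sort] at hc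
    have hbot : I = ⊥ := by rw [hA, hc]; simp
    have := idealHeight_le_height (I := I) (q := ⊥) hbot.le
    rw [hht, Ideal.height_bot] at this
    simp at this
  obtain ⟨E, hE, hcard, hsyz⟩ := exists_monomialSyzygy_finset (K := K) (ι := A) (fun d => d.1)
    (I := I) (by rw [hA, Set.image_eq_range]; rfl) hIm rs hrs hreg (by omega)
  obtain ⟨h, J, hJ, hIJ⟩ := exists_pairFiltered_of_card_lt (K := K) (fun d : A => d.1)
    (Fintype.card A - 1) Finset.univ
    (by rw [Finset.card_univ]; have := Fintype.card_pos (α := A); omega) E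
    (fun e he => ⟨hE e he, Finset.mem_univ _, Finset.mem_univ _⟩)
    (by rwa [Finset.card_univ]) (fun z _ hz => hsyz z hz)
  have hIJ' : I = Ideal.span {monomial h 1} * J := by
    rw [← hIJ, hA, Set.image_eq_range]
    simp
  have h0 : h = 0 := by
    ext i
    by_contra hi
    refine hX i (hIJ' ▸ Ideal.mul_le_left.trans ?_)
    rw [Ideal.span_singleton_le_iff_mem]
    exact monomial_mem_of_X_mem hi (Ideal.mem_span_singleton_self _)
  have hI' : PairFiltered I := by
    rw [hIJ', h0]
    simpa [Ideal.one_eq_top] using hJ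
  obtain ⟨r, F, P, hF, hP⟩ := hI'.exists_isPrimeFiltration
  refine ⟨r, F, P, hF, fun k => ?_⟩
  obtain ⟨i, j, -, hPk, hle⟩ := hP k
  rw [hPk] at hle ⊢
  exact mem_minimalPrimes_of_isMonomialIdeal hA hX hle
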